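/- arXiv:1709.03121 — 5 statements merged into one kernel-verified Lean document; each statement's English description precedes it below -/
import Mathlib

section
/- For every N ≥ 1, in the game where from the initial vertex v₀ the play moves to a vertex v while performing N increments of the single counter, and from v Eve may either move to the target F performing N increments, or for any ℓ ∈ {1,…,N} move through u_ℓ back to v performing N−ℓ increments, then a reset, then ℓ−1 increments, the following hold: Eve has a strategy with N+1 memory states ensuring B(N) Until F (going successively through u_N, u_{N−1}, …, u_1 and then to F), Eve has a positional (1 memory state) strategy ensuring B(2N) Until F (going directly to F), and no strategy of Eve with fewer than N+1 memory states ensures B(N) Until F. -/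
/-- A counter action: leave unchanged, increment, or reset. -/
inductive CAct : Type
  | eps
  | inc
  | reset
  deriving DecidableEq

/-- Effect of one counter action on a counter value. -/
def updC : ℕ → CAct → ℕ
  | c, .eps => c
  | c, .inc => c + 1
  | _, .reset => 0

/-- Final counter value after performing a finite sequence of actions,
starting from value `c`. -/
def runList : ℕ → List CAct → ℕ
  | c, [] => c
  | c, a :: l => runList (updC c a) l

/-- Maximal counter value reached while performing a finite sequence of
actions, starting from value `c`. -/
def peakList : ℕ → List CAct → ℕ
  | c, [] => c
  | c, a :: l => max c (peakList (updC c a) l)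

/-- A game with one counter: `step v v' = some l` means that there is an edge
from `v` to `v'` performing the finite sequence `l` of counter actions, and
`step v v' = none` that there is no edge from `v` to `v'`. `eve` is the set of
vertices controlled by Eve. -/
structure GameA (V : Type) where
  step : V → V → Option (List CAct)
  eve : V → Prop

namespace GameA

variable {V : Type}

/-- An infinite play: a sequence of vertices following edges. -/
def IsPlay (G : GameA V) (π : ℕ → V) : Prop :=
  ∀ n, (G.step (π n) (π (n + 1))).isSome

/-- The counter value after `n` steps of the play `π` (the counter starts at 0). -/
def cval (G : GameA V) (π : ℕ → V) : ℕ → ℕ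
  | 0 => 0
  | n + 1 => runList (G.cval π n) ((G.step (π n) (π (n + 1))).getD [])

/-- The condition `B(N) Until F`: the play reaches `F` and all counter values
up to that point are at most `N`. -/
def UntilB (G : GameA V) (F : Set V) (N : ℕ) (π : ℕ → V) : Prop :=
  ∃ n, π n ∈ F ∧
    ∀ m, m < n → peakList (G.cval π m) ((G.step (π m) (π (m + 1))).getD []) ≤ N

end GameA

/-- A strategy for Eve with memory `M`: an initial memory state, a memory
update function reading edges, and a next-move function. -/
structure StrategyA (V M : Type) where
  init : M
  update : M → V → V → M
  move : V → M → V

namespace StrategyA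

variable {V M : Type}

/-- Memory state after `n` steps of the play `π`. -/
def memAt (S : StrategyA V M) (π : ℕ → V) : ℕ → M
  | 0 => S.init
  | n + 1 => S.update (S.memAt π n) (π n) (π (n + 1))

/-- A play is consistent with a strategy if every move from an Eve vertex is
the one chosen by the strategy. -/
def Consistent (G : GameA V) (S : StrategyA V M) (π : ℕ → V) : Prop :=
  ∀ n, G.eve (π n) → π (n + 1) = S.move (π n) (S.memAt π n)

/-- A strategy is valid if, at every Eve vertex having an outgoing edge, it
picks an outgoing edge of that vertex. -/
def Valid (G : GameA V) (S : StrategyA V M) : Prop :=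
  ∀ v m, G.eve v → (∃ v', (G.step v v').isSome) → (G.step v (S.move v m)).isSome

end StrategyA

/-- A strategy ensures a condition from `v₀` if every play from `v₀` consistent
with it satisfies the condition. -/
def EnsuresA {V M : Type} (G : GameA V) (S : StrategyA V M) (v₀ : V)
    (Wc : (ℕ → V) → Prop) : Prop :=
  ∀ π : ℕ → V, π 0 = v₀ → G.IsPlay π → S.Consistent G π → Wc π

/-- Vertices of the game of Statement 0: `start` is the initial vertex `v₀`,
`mid` is the vertex `v`, `pass ℓ` is the vertex `u_ℓ`, and `target` is `F`
(made absorbing by a self-loop with no counter action). -/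
inductive TV : Type
  | start
  | mid
  | pass (ℓ : ℕ)
  | target
  deriving DecidableEq

/-- The edges of the game of Statement 0, with their counter actions:
* from `v₀`, the play moves to `v` performing `N` increments;
* from `v`, Eve may move to `F` performing `N` increments;
* for `1 ≤ ℓ ≤ N`, Eve may move from `v` through `u_ℓ` back to `v`, performing
  `N − ℓ` increments, then a reset, then `ℓ − 1` increments. -/
def tradeStep (N : ℕ) : TV → TV → Option (List CAct)
  | .start, .mid => some (List.replicate N .inc)
  | .mid, .target => some (List.replicate N .inc)
  | .mid, .pass ℓ =>
      if 1 ≤ ℓ ∧ ℓ ≤ N then some (List.replicate (N - ℓ) .inc) else none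
  | .pass ℓ, .mid =>
      if 1 ≤ ℓ ∧ ℓ ≤ N then some (.reset :: List.replicate (ℓ - 1) .inc) else none
  | .target, .target => some ([] : List CAct)
  | _, _ => none

/-- The game of Statement 0 (all vertices belong to Eve; Adam plays no role). -/
def tradeGame (N : ℕ) : GameA TV := ⟨tradeStep N, fun _ => True⟩

theorem runList_replicate_inc (c k : ℕ) : runList c (List.replicate k .inc) = c + k := by
  induction k generalizing c with
  | zero => rfl
  | succ k ih => simp only [List.replicate_succ, runList, updC, ih]; omega

theorem peakList_replicate_inc (c k : ℕ) : peakList c (List.replicate k .inc) = c + k := by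
  induction k generalizing c with
  | zero => rfl
  | succ k ih => simp only [List.replicate_succ, peakList, updC, ih]; omega

theorem runList_reset_replicate_inc (c k : ℕ) :
    runList c (.reset :: List.replicate k .inc) = k := by
  simp [runList, updC, runList_replicate_inc]

theorem peakList_reset_replicate_inc (c k : ℕ) :
    peakList c (.reset :: List.replicate k .inc) = max c k := by
  simp [peakList, updC, peakList_replicate_inc]

namespace GameA

variable {V : Type} {G : GameA V} {π : ℕ → V} {n : ℕ} {v w : V} {l : List CAct}

/-- The counter value after a step is obtained by running the actions of the edge taken. -/
theorem cval_succ_of_step (hv : π n = v) (hw : π (n + 1) = w) (h : G.step v w = some l) :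
    G.cval π (n + 1) = runList (G.cval π n) l := by
  simp [cval, hv, hw, h]

/-- All counter values during the first `n` steps of `π` are at most `B`. -/
def BoundedBefore (G : GameA V) (B : ℕ) (π : ℕ → V) (n : ℕ) : Prop :=
  ∀ m, m < n → peakList (G.cval π m) ((G.step (π m) (π (m + 1))).getD []) ≤ B

theorem BoundedBefore.zero {B : ℕ} : G.BoundedBefore B π 0 := by
  intro m hm; omega

theorem BoundedBefore.succ {B : ℕ} (hB : G.BoundedBefore B π n) (hv : π n = v)
    (hw : π (n + 1) = w) (h : G.step v w = some l) (hl : peakList (G.cval π n) l ≤ B) :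
    G.BoundedBefore B π (n + 1) := by
  intro m hm
  rcases Nat.lt_succ_iff_lt_or_eq.mp hm with hm | rfl
  · exact hB m hm
  · simpa [hv, hw, h] using hl

theorem BoundedBefore.peakList_le {B : ℕ} (hB : G.BoundedBefore B π (n + 1)) (hv : π n = v)
    (hw : π (n + 1) = w) (h : G.step v w = some l) : peakList (G.cval π n) l ≤ B := by
  simpa [hv, hw, h] using hB n n.lt_succ_self

theorem BoundedBefore.of_succ {B : ℕ} (hB : G.BoundedBefore B π (n + 1)) :
    G.BoundedBefore B π n :=
  fun m hm => hB m (hm.trans n.lt_succ_self)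

end GameA

namespace StrategyA

variable {V M : Type}

/-- The vertex and memory state after `n` steps from `v₀` when every move follows `S`. -/
def outcomeState (S : StrategyA V M) (v₀ : V) : ℕ → V × M
  | 0 => (v₀, S.init)
  | n + 1 =>
    let p := S.outcomeState v₀ n
    (S.move p.1 p.2, S.update p.2 p.1 (S.move p.1 p.2))

/-- The play from `v₀` in which every move follows `S`. -/
def outcome (S : StrategyA V M) (v₀ : V) (n : ℕ) : V := (S.outcomeState v₀ n).1

theorem memAt_outcome (S : StrategyA V M) (v₀ : V) (n : ℕ) :
    S.memAt (S.outcome v₀) n = (S.outcomeState v₀ n).2 := by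
  induction n with
  | zero => rfl
  | succ n ih => simp only [memAt, ih]; rfl

theorem outcome_succ (S : StrategyA V M) (v₀ : V) (n : ℕ) :
    S.outcome v₀ (n + 1) = S.move (S.outcome v₀ n) (S.memAt (S.outcome v₀) n) := by
  rw [memAt_outcome]; rfl

theorem consistent_outcome (G : GameA V) (S : StrategyA V M) (v₀ : V) :
    S.Consistent G (S.outcome v₀) :=
  fun n _ => S.outcome_succ v₀ n

end StrategyA

section TradeGame

variable {N ℓ : ℕ}

theorem tradeGame_step_start_mid :
    (tradeGame N).step .start .mid = some (List.replicate N .inc) := rfl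

theorem tradeGame_step_mid_target :
    (tradeGame N).step .mid .target = some (List.replicate N .inc) := rfl

theorem tradeGame_step_mid_pass (h : 1 ≤ ℓ ∧ ℓ ≤ N) :
    (tradeGame N).step .mid (.pass ℓ) = some (List.replicate (N - ℓ) .inc) := if_pos h

theorem tradeGame_step_pass_mid (h : 1 ≤ ℓ ∧ ℓ ≤ N) :
    (tradeGame N).step (.pass ℓ) .mid = some (.reset :: List.replicate (ℓ - 1) .inc) := if_pos h

theorem tradeGame_step_isSome_cases {v w : TV} (h : ((tradeGame N).step v w).isSome) :
    (v = .start ∧ w = .mid) ∨ (v = .mid ∧ w = .target) ∨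
      (∃ ℓ, (1 ≤ ℓ ∧ ℓ ≤ N) ∧ v = .mid ∧ w = .pass ℓ) ∨
      (∃ ℓ, (1 ≤ ℓ ∧ ℓ ≤ N) ∧ v = .pass ℓ ∧ w = .mid) ∨ (v = .target ∧ w = .target) := by
  cases v <;> cases w <;> simp_all [tradeGame, tradeStep]

/-- A vertex reached by an edge has an outgoing edge. -/
theorem tradeGame_exists_step_of_step {v w : TV} (h : ((tradeGame N).step v w).isSome) :
    ∃ w', ((tradeGame N).step w w').isSome := by
  rcases tradeGame_step_isSome_cases h with
    ⟨-, rfl⟩ | ⟨-, rfl⟩ | ⟨ℓ, hℓ, -, rfl⟩ | ⟨ℓ, hℓ, -, rfl⟩ | ⟨-, rfl⟩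
  · exact ⟨.target, rfl⟩
  · exact ⟨.target, rfl⟩
  · exact ⟨.mid, by simp [tradeGame_step_pass_mid hℓ]⟩
  · exact ⟨.target, rfl⟩
  · exact ⟨.target, rfl⟩

theorem isPlay_outcome_of_valid {M : Type} {S : StrategyA TV M} (hS : S.Valid (tradeGame N)) :
    (tradeGame N).IsPlay (S.outcome .start) := by
  have follow (n : ℕ) (h : ∃ w, ((tradeGame N).step (S.outcome .start n) w).isSome) :
      ((tradeGame N).step (S.outcome .start n) (S.outcome .start (n + 1))).isSome := by
    rw [S.outcome_succ]
    exact hS _ _ trivial h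
  intro n
  induction n with
  | zero => exact follow 0 ⟨.mid, rfl⟩
  | succ n ih => exact follow (n + 1) (tradeGame_exists_step_of_step ih)

/-- `u_ℓ` for `ℓ ≥ 1`, and the target for `ℓ = 0`. -/
def exitVertex (ℓ : ℕ) : TV := if ℓ = 0 then .target else .pass ℓ

theorem exitVertex_injective : Function.Injective exitVertex := by
  intro a b h
  unfold exitVertex at h
  split_ifs at h <;> simp_all

theorem exitVertex_succ : exitVertex (ℓ + 1) = .pass (ℓ + 1) := if_neg ℓ.succ_ne_zero

theorem tradeGame_step_mid_exitVertex_isSome (h : ℓ ≤ N) :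
    ((tradeGame N).step .mid (exitVertex ℓ)).isSome := by
  cases ℓ with
  | zero => rfl
  | succ ℓ => simp [exitVertex_succ, tradeGame_step_mid_pass ⟨ℓ.succ_pos, h⟩]

/-- The strategy going successively through `u_N, …, u_1` and then to the target. -/
def descendStrategy (N : ℕ) : StrategyA TV (Fin (N + 1)) where
  init := Fin.last N
  update m v _ := if v = .mid then ⟨m - 1, by omega⟩ else m
  move v m :=
    match v with
    | .start => .mid
    | .mid => exitVertex m
    | .pass _ => .mid
    | .target => .target

theorem descendStrategy_valid : (descendStrategy N).Valid (tradeGame N) := by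
  rintro v m - ⟨w, hw⟩
  rcases tradeGame_step_isSome_cases hw with
    ⟨rfl, -⟩ | ⟨rfl, -⟩ | ⟨ℓ, hℓ, rfl, -⟩ | ⟨ℓ, hℓ, rfl, rfl⟩ | ⟨rfl, -⟩
  · rfl
  · exact tradeGame_step_mid_exitVertex_isSome (Nat.le_of_lt_succ m.isLt)
  · exact tradeGame_step_mid_exitVertex_isSome (Nat.le_of_lt_succ m.isLt)
  · exact hw
  · rfl

/-- From `v` with counter value and memory state `c`, the descending strategy wins. -/
theorem untilB_of_descendStrategy {π : ℕ → TV}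
    (hc : (descendStrategy N).Consistent (tradeGame N) π) (c n : ℕ) (hv : π n = .mid)
    (hm : ((descendStrategy N).memAt π n : ℕ) = c) (hcv : (tradeGame N).cval π n = c)
    (hB : (tradeGame N).BoundedBefore N π n) :
    (tradeGame N).UntilB {TV.target} N π := by
  induction c generalizing n with
  | zero =>
    have h1 : π (n + 1) = .target := by
      rw [hc n trivial, hv]
      exact congrArg exitVertex hm
    exact ⟨n + 1, h1, hB.succ hv h1 tradeGame_step_mid_target
      (by rw [peakList_replicate_inc]; omega)⟩
  | succ c ih =>
    have hle : 1 ≤ c + 1 ∧ c + 1 ≤ N := by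
      have := ((descendStrategy N).memAt π n).isLt
      omega
    have h1 : π (n + 1) = .pass (c + 1) := by
      rw [hc n trivial, hv, ← exitVertex_succ]
      exact congrArg exitVertex hm
    have h2 : π (n + 2) = .mid := by simp [hc (n + 1) trivial, h1, descendStrategy]
    have hm1 : ((descendStrategy N).memAt π (n + 1) : ℕ) = c := by
      have : ((descendStrategy N).memAt π (n + 1) : ℕ) = (descendStrategy N).memAt π n - 1 := by
        simp [StrategyA.memAt, descendStrategy, hv]
      omega
    have hm2 : (descendStrategy N).memAt π (n + 2) = (descendStrategy N).memAt π (n + 1) := by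
      rw [StrategyA.memAt, h1]; simp [descendStrategy]
    have hc1 := GameA.cval_succ_of_step hv h1 (tradeGame_step_mid_pass hle)
    have hc2 := GameA.cval_succ_of_step h1 h2 (tradeGame_step_pass_mid hle)
    rw [runList_replicate_inc] at hc1
    rw [runList_reset_replicate_inc] at hc2
    refine ih (n + 2) h2 (by rw [hm2, hm1]) hc2
      ((hB.succ hv h1 (tradeGame_step_mid_pass hle) ?_).succ h1 h2
        (tradeGame_step_pass_mid hle) ?_)
    · rw [peakList_replicate_inc]; omega
    · rw [peakList_reset_replicate_inc]; omega

theorem descendStrategy_ensures :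
    EnsuresA (tradeGame N) (descendStrategy N) .start
      ((tradeGame N).UntilB {TV.target} N) := by
  intro π h0 _ hc
  have h1 : π 1 = .mid := by simp [hc 0 trivial, h0, descendStrategy]
  refine untilB_of_descendStrategy hc N 1 h1 ?_ ?_ ?_
  · simp [StrategyA.memAt, h0, descendStrategy]
  · rw [GameA.cval_succ_of_step h0 h1 tradeGame_step_start_mid, runList_replicate_inc]
    simp [GameA.cval]
  · refine GameA.BoundedBefore.zero.succ h0 h1 tradeGame_step_start_mid ?_
    rw [peakList_replicate_inc]
    simp [GameA.cval]

/-- The positional strategy going directly to the target. -/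
def directStrategy : StrategyA TV (Fin 1) where
  init := 0
  update m _ _ := m
  move v _ :=
    match v with
    | .start => .mid
    | .mid => .target
    | .pass _ => .mid
    | .target => .target

theorem directStrategy_valid : directStrategy.Valid (tradeGame N) := by
  rintro v m - ⟨w, hw⟩
  rcases tradeGame_step_isSome_cases hw with
    ⟨rfl, -⟩ | ⟨rfl, -⟩ | ⟨ℓ, hℓ, rfl, -⟩ | ⟨ℓ, hℓ, rfl, rfl⟩ | ⟨rfl, -⟩
  all_goals first | rfl | exact hw

theorem directStrategy_ensures :
    EnsuresA (tradeGame N) directStrategy .start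
      ((tradeGame N).UntilB {TV.target} (2 * N)) := by
  intro π h0 _ hc
  have h1 : π 1 = .mid := by simp [hc 0 trivial, h0, directStrategy]
  have h2 : π 2 = .target := by simp [hc 1 trivial, h1, directStrategy]
  have hc1 := GameA.cval_succ_of_step h0 h1 (tradeGame_step_start_mid (N := N))
  rw [runList_replicate_inc, GameA.cval] at hc1
  refine ⟨2, h2, (GameA.BoundedBefore.zero.succ h0 h1 tradeGame_step_start_mid ?_).succ h1 h2
    tradeGame_step_mid_target ?_⟩
  · rw [peakList_replicate_inc, GameA.cval]; omega
  · rw [peakList_replicate_inc]; omega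

/-- Along a play from `v₀` with values at most `N`, the moves `u_ℓ` out of `v` that have already
been used include all those with `ℓ` larger than the current counter value. -/
theorem exits_used {π : ℕ → TV} (h0 : π 0 = .start) (hp : (tradeGame N).IsPlay π) (n : ℕ)
    (hB : (tradeGame N).BoundedBefore N π n) :
    (π n = .start → (tradeGame N).cval π n = 0) ∧
    (π n = .mid → ∀ ℓ, (tradeGame N).cval π n < ℓ → ℓ ≤ N →
      ∃ k, π k = .mid ∧ π (k + 1) = exitVertex ℓ) ∧
    (∀ p, π n = .pass p → ∀ ℓ, p ≤ ℓ → ℓ ≤ N → ∃ k, π k = .mid ∧ π (k + 1) = exitVertex ℓ) ∧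
    (π n = .target → ∀ ℓ, ℓ ≤ N → ∃ k, π k = .mid ∧ π (k + 1) = exitVertex ℓ) := by
  induction n with
  | zero => simp [h0, GameA.cval]
  | succ n ih =>
    obtain ⟨ihs, ihm, ihp, iht⟩ := ih hB.of_succ
    rcases tradeGame_step_isSome_cases (hp n) with
      ⟨hv, hw⟩ | ⟨hv, hw⟩ | ⟨p, hle, hv, hw⟩ | ⟨p, hle, hv, hw⟩ | ⟨hv, hw⟩
    · have hcv := GameA.cval_succ_of_step hv hw (tradeGame_step_start_mid (N := N))
      rw [runList_replicate_inc] at hcv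
      simp only [hw, reduceCtorEq, false_implies, implies_true, true_and, and_true, true_implies]
      intro ℓ h1 h2
      omega
    · have hpk := hB.peakList_le hv hw tradeGame_step_mid_target
      rw [peakList_replicate_inc] at hpk
      simp only [hw, reduceCtorEq, false_implies, implies_true, true_and, true_implies]
      intro ℓ hℓ
      rcases Nat.eq_zero_or_pos ℓ with rfl | h
      · exact ⟨n, hv, hw⟩
      · exact ihm hv ℓ (by omega) hℓ
    · have hpk := hB.peakList_le hv hw (tradeGame_step_mid_pass hle)
      rw [peakList_replicate_inc] at hpk
      simp only [hw, reduceCtorEq, false_implies, true_and, and_true, TV.pass.injEq]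
      rintro _ rfl ℓ h1 h2
      rcases h1.eq_or_lt with rfl | h
      · exact ⟨n, hv, by rw [hw, exitVertex, if_neg (by omega)]⟩
      · exact ihm hv ℓ (by omega) h2
    · have hcv := GameA.cval_succ_of_step hv hw (tradeGame_step_pass_mid hle)
      rw [runList_reset_replicate_inc] at hcv
      simp only [hw, reduceCtorEq, false_implies, implies_true, true_and, and_true, true_implies]
      exact fun ℓ h1 h2 => ihp p hv ℓ (by omega) h2
    · simp only [hw, reduceCtorEq, false_implies, implies_true, true_and, true_implies]
      exact iht hv

theorem card_memory_of_ensures {M : Type} [Fintype M] {S : StrategyA TV M}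
    (hS : S.Valid (tradeGame N))
    (hE : EnsuresA (tradeGame N) S .start ((tradeGame N).UntilB {TV.target} N)) :
    N + 1 ≤ Fintype.card M := by
  have hp := isPlay_outcome_of_valid hS
  obtain ⟨n, hn, hB⟩ := hE _ rfl hp (S.consistent_outcome _ _)
  have key (i : Fin (N + 1)) : ∃ m, S.move .mid m = exitVertex i := by
    obtain ⟨k, hk, hk1⟩ := (exits_used rfl hp n hB).2.2.2 hn i (by omega)
    exact ⟨S.memAt (S.outcome .start) k, by rw [← hk1, S.outcome_succ, hk]⟩
  choose f hf using key
  have hinj : Function.Injective f := fun i j h =>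
    Fin.ext (exitVertex_injective (by rw [← hf i, ← hf j, h]))
  simpa using Fintype.card_le_of_injective f hinj

end TradeGame

/-- For every `N ≥ 1`, in the above game:
* Eve has a strategy with `N+1` memory states ensuring `B(N) Until F`;
* Eve has a positional (1 memory state) strategy ensuring `B(2N) Until F`;
* no strategy of Eve with fewer than `N+1` memory states ensures `B(N) Until F`. -/
theorem statement0 (N : ℕ) (hN : 1 ≤ N) :
    (∃ S : StrategyA TV (Fin (N + 1)), S.Valid (tradeGame N) ∧
      EnsuresA (tradeGame N) S .start ((tradeGame N).UntilB {TV.target} N)) ∧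
    (∃ S : StrategyA TV (Fin 1), S.Valid (tradeGame N) ∧
      EnsuresA (tradeGame N) S .start ((tradeGame N).UntilB {TV.target} (2 * N))) ∧
    (∀ (M : Type) [Fintype M], Fintype.card M < N + 1 →
      ∀ S : StrategyA TV M, S.Valid (tradeGame N) →
        ¬ EnsuresA (tradeGame N) S .start ((tradeGame N).UntilB {TV.target} N)) := by
  exact ⟨⟨descendStrategy N, descendStrategy_valid, descendStrategy_ensures⟩,
    ⟨directStrategy, directStrategy_valid, directStrategy_ensures⟩,
    fun M _ hM S hS hE => hM.not_ge (card_memory_of_ensures hS hE)⟩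
end

section
/- In the game with k ≥ 1 counters numbered cyclically, a single vertex controlled by Eve, and k self-loops where the j-th loop increments counter j and resets counter j−1 (indices modulo k), Eve has a strategy with k memory states ensuring B(1) (cycling through the loops), and for every N, no strategy of Eve using fewer than k memory states ensures B(N). -/
/-- An arena with vertices `V`, edges `E` and `k` counters: each edge has a
source, a target and a counter action in `{ε,i,r}^k`; `eve` is the set of
vertices controlled by Eve. -/
structure Arena (V E : Type) (k : ℕ) where
  src : E → V
  tgt : E → V
  act : E → Fin k → CAct
  eve : V → Prop

namespace Arena

variable {V E : Type} {k : ℕ}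

/-- An infinite play, as a sequence of consecutive edges. -/
def IsPath (A : Arena V E k) (π : ℕ → E) : Prop :=
  ∀ n, A.tgt (π n) = A.src (π (n + 1))

/-- Value of counter `j` after `n` steps of the play `π` (counters start at 0). -/
def cval (A : Arena V E k) (π : ℕ → E) (j : Fin k) : ℕ → ℕ
  | 0 => 0
  | n + 1 => updC (A.cval π j n) (A.act (π n) j)

/-- The condition `B(N)`: all counter values stay at most `N` along the play. -/
def BoundedBy (A : Arena V E k) (π : ℕ → E) (N : ℕ) : Prop :=
  ∀ (j : Fin k) (n : ℕ), A.cval π j n ≤ N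

end Arena

/-- A strategy for Eve with memory `M`: an initial memory state, a memory
update function reading edges, and a next-move function. -/
structure Strategy (V E M : Type) where
  init : M
  update : M → E → M
  move : V → M → E

namespace Strategy

variable {V E M : Type} {k : ℕ}

/-- Memory state after `n` steps of the play `π`. -/
def memAt (S : Strategy V E M) (π : ℕ → E) : ℕ → M
  | 0 => S.init
  | n + 1 => S.update (S.memAt π n) (π n)

/-- A play is consistent with a strategy if every move from an Eve vertex is
the one chosen by the strategy. -/
def Consistent (A : Arena V E k) (S : Strategy V E M) (π : ℕ → E) : Prop :=
  ∀ n, A.eve (A.src (π n)) → π n = S.move (A.src (π n)) (S.memAt π n)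

/-- A strategy is valid if, at every Eve vertex having an outgoing edge, it
picks an outgoing edge of that vertex. -/
def Valid (A : Arena V E k) (S : Strategy V E M) : Prop :=
  ∀ v m, A.eve v → (∃ e, A.src e = v) → A.src (S.move v m) = v

end Strategy

/-- A strategy ensures a condition from `v₀` if every play from `v₀`
consistent with it satisfies the condition. -/
def Ensures {V E M : Type} {k : ℕ} (A : Arena V E k) (S : Strategy V E M)
    (v₀ : V) (Wc : (ℕ → E) → Prop) : Prop :=
  ∀ π : ℕ → E, A.src (π 0) = v₀ → A.IsPath π → S.Consistent A π → Wc π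

/-- A property of positions holds infinitely often. -/
def InfOften (p : ℕ → Prop) : Prop := ∀ n, ∃ m, n ≤ m ∧ p m

/-- The parity condition: the maximal colour seen infinitely often is even. -/
def ParityPlay {V E : Type} {k : ℕ} (A : Arena V E k) (Ω : V → ℕ) (π : ℕ → E) : Prop :=
  ∃ c, Even c ∧ InfOften (fun n => Ω (A.src (π n)) = c) ∧
    ∀ c', c < c' → ¬ InfOften (fun n => Ω (A.src (π n)) = c')

/-- The one-vertex arena with `k` counters (numbered cyclically) and `k`
self-loops: the `ℓ`-th loop increments counter `ℓ` and resets counter `ℓ - 1`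
(indices modulo `k`). -/
def loopArena (k : ℕ) : Arena Unit (Fin k) k where
  src _ := ()
  tgt _ := ()
  act e := fun c =>
    if ((c : ℕ) + 1) % k = (e : ℕ) then CAct.reset
    else if c = e then CAct.inc
    else CAct.eps
  eve _ := True

open Filter in
/-- In a bounded play, if the loop following loop `a` is eventually avoided, then so is loop `a`. -/
theorem loopArena_eventually_ne_of_succ {k N : ℕ} (hk : 1 ≤ k) {π : ℕ → Fin k}
    (hb : (loopArena k).BoundedBy π N) {a : ℕ}
    (h : ∀ᶠ n in atTop, (π n : ℕ) ≠ (a + 1) % k) :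
    ∀ᶠ n in atTop, (π n : ℕ) ≠ a % k := by
  by_contra hfreq
  obtain ⟨n₀, hn₀⟩ := eventually_atTop.1 h
  let j : Fin k := ⟨a % k, Nat.mod_lt _ hk⟩
  have hreset : ∀ n, n₀ ≤ n → ((j : ℕ) + 1) % k ≠ (π n : ℕ) := fun n hn he =>
    hn₀ n hn (by rw [← he]; simp [j])
  have hstep : ∀ n, n₀ ≤ n → (loopArena k).cval π j (n + 1) =
      (loopArena k).cval π j n + if j = π n then 1 else 0 := by
    intro n hn
    by_cases hj : j = π n
    · simp only [Arena.cval, loopArena, if_neg (hreset n hn), if_pos hj, updC]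
    · simp only [Arena.cval, loopArena, if_neg (hreset n hn), if_neg hj, updC, add_zero]
  have hmono : ∀ n, n₀ ≤ n → ∀ d,
      (loopArena k).cval π j n ≤ (loopArena k).cval π j (n + d) := by
    intro n hn d
    induction d with
    | zero => exact le_rfl
    | succ d ih =>
      have := hstep (n + d) (by omega)
      rw [← add_assoc]
      omega
  have hlarge : ∀ B : ℕ, ∃ n, n₀ ≤ n ∧ B ≤ (loopArena k).cval π j n := by
    intro B
    induction B with
    | zero => exact ⟨n₀, le_rfl, Nat.zero_le _⟩
    | succ B ih =>
      obtain ⟨n, hn, hB⟩ := ih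
      rw [eventually_atTop] at hfreq
      push Not at hfreq
      obtain ⟨m, hm, hπ⟩ := hfreq n
      refine ⟨m + 1, by omega, ?_⟩
      have h1 := hmono n hn (m - n)
      rw [Nat.add_sub_cancel' hm] at h1
      rw [hstep m (by omega), if_pos (Fin.ext hπ.symm)]
      omega
  obtain ⟨n, -, hn⟩ := hlarge (N + 1)
  have := hb j n
  omega

open Filter in
/-- A bounded play takes every loop infinitely often. -/
theorem loopArena_frequently_of_bounded {k N : ℕ} (hk : 1 ≤ k) {π : ℕ → Fin k}
    (hb : (loopArena k).BoundedBy π N) (e : Fin k) : ∃ᶠ n in atTop, π n = e := by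
  intro he
  have hdown : ∀ a : ℕ, (∀ᶠ n in atTop, (π n : ℕ) ≠ a % k) →
      ∀ b, b ≤ a → ∀ᶠ n in atTop, (π n : ℕ) ≠ b % k := fun a ha b hba =>
    Nat.decreasingInduction (motive := fun b _ => ∀ᶠ n in atTop, (π n : ℕ) ≠ b % k)
      (fun _ _ ih => loopArena_eventually_ne_of_succ hk hb ih) ha hba
  have hzero : ∀ᶠ n in atTop, (π n : ℕ) ≠ 0 % k := by
    refine hdown e ?_ 0 (Nat.zero_le _)
    filter_upwards [he] with n hn h
    rw [Nat.mod_eq_of_lt e.isLt] at h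
    exact hn (Fin.ext h)
  have hall : ∀ᶠ n in atTop, ∀ b : Fin k, (π n : ℕ) ≠ (b : ℕ) % k := by
    rw [eventually_all]
    intro b
    refine hdown k ?_ b b.isLt.le
    simpa using hzero
  obtain ⟨n, hn⟩ := hall.exists
  exact hn (π n) (Nat.mod_eq_of_lt (π n).isLt).symm

/-- Cycling through the loops keeps every counter at most `1`. -/
theorem loopArena_boundedBy_one_of_cyclic {k : ℕ} {π : ℕ → Fin k}
    (hπ : ∀ n, (π n : ℕ) = n % k) : (loopArena k).BoundedBy π 1 := by
  intro j n
  suffices h : (loopArena k).cval π j n ≤ if n % k = ((j : ℕ) + 1) % k then 1 else 0 by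
    split_ifs at h <;> omega
  induction n with
  | zero => simp [Arena.cval]
  | succ n ih =>
    by_cases hr : ((j : ℕ) + 1) % k = (π n : ℕ)
    · simp only [Arena.cval, loopArena, if_pos hr, updC]
      exact Nat.zero_le _
    · have h0 : (loopArena k).cval π j n = 0 := by
        rw [if_neg (fun h => hr (by rw [hπ, h]))] at ih
        omega
      by_cases hj : j = π n
      · have hmod : (n + 1) % k = ((j : ℕ) + 1) % k := by
          rw [hj, hπ, Nat.mod_add_mod]
        have hinc : (loopArena k).cval π j (n + 1) = (loopArena k).cval π j n + 1 := by
          simp only [Arena.cval, loopArena, if_neg hr, if_pos hj, updC]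
        rw [hinc, h0, if_pos hmod]
      · have heps : (loopArena k).cval π j (n + 1) = (loopArena k).cval π j n := by
          simp only [Arena.cval, loopArena, if_neg hr, if_neg hj, updC]
        rw [heps, h0]
        exact Nat.zero_le _

/-- In the game with `k ≥ 1` counters numbered cyclically, a
single vertex controlled by Eve and `k` self-loops, where the `j`-th loop
increments counter `j` and resets counter `j−1` (modulo `k`): Eve has a
strategy with `k` memory states ensuring `B(1)`, and for every `N`, no strategy
of Eve using fewer than `k` memory states ensures `B(N)`. -/
theorem statement1 (k : ℕ) (hk : 1 ≤ k) :
    (∃ S : Strategy Unit (Fin k) (Fin k), S.Valid (loopArena k) ∧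
      Ensures (loopArena k) S () fun π => (loopArena k).BoundedBy π 1) ∧
    (∀ (N : ℕ) (M : Type) [Fintype M], Fintype.card M < k →
      ∀ S : Strategy Unit (Fin k) M, S.Valid (loopArena k) →
        ¬ Ensures (loopArena k) S () fun π => (loopArena k).BoundedBy π N) := by
  refine ⟨⟨⟨⟨0, hk⟩, fun m _ => ⟨(m + 1) % k, Nat.mod_lt _ hk⟩, fun _ m => m⟩,
    fun _ _ _ _ => rfl, fun π _ _ hc => loopArena_boundedBy_one_of_cyclic fun n => ?_⟩, ?_⟩
  · rw [hc n trivial]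
    clear hc
    dsimp only
    induction n with
    | zero => simp [Strategy.memAt]
    | succ n ih => simp [Strategy.memAt, ih]
  · intro N M _ hM S _ hS
    obtain ⟨e, he⟩ : ∃ e, ∀ m, S.move () m ≠ e := by
      by_contra! h
      have := Fintype.card_le_of_surjective (S.move ()) h
      rw [Fintype.card_fin] at this
      omega
    let mem : ℕ → M := fun n => (fun m => S.update m (S.move () m))^[n] S.init
    let π : ℕ → Fin k := fun n => S.move () (mem n)
    have hmem : ∀ n, S.memAt π n = mem n := by
      intro n
      induction n with
      | zero => rfl
      | succ n ih => simp only [Strategy.memAt, ih, π, mem, Function.iterate_succ_apply']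
    have hb := hS π rfl (fun _ => rfl) fun n _ => by rw [hmem]
    obtain ⟨n, hn⟩ := (loopArena_frequently_of_bounded hk hb e).exists
    exact he _ hn
end

section
/- In the game G₁, Eve has a strategy with 4 memory states ensuring B(3) Until F from every vertex v_n. -/
/-- Vertices of the game `G₁`: Eve's vertices `u n`, Adam's vertices `v n`,
and the target `F` (made absorbing by a self-loop with no counter action). -/
inductive G1V : Type
  | u (n : ℕ)
  | v (n : ℕ)
  | target
  deriving DecidableEq

/-- The edges of `G₁`, with their counter actions:
`v_{n+1} → v_n` (ε), `v_n → u_n` (ε), `u_{n+1} → v_n` (i), `u_0 → F` (i),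
and `u_n → v_{n+2}` (r). -/
def g1Step : G1V → G1V → Option (List CAct)
  | .v n, .v m => if n = m + 1 then some [.eps] else none
  | .v n, .u m => if n = m then some [.eps] else none
  | .u n, .v m =>
      if n = m + 1 then some [.inc]
      else if m = n + 2 then some [.reset]
      else none
  | .u n, .target => if n = 0 then some [.inc] else none
  | .target, .target => some ([] : List CAct)
  | _, _ => none

/-- The game `G₁`: the vertices `u n` belong to Eve, the rest to Adam. -/
def G1 : GameA G1V :=
  ⟨g1Step, fun x => match x with
    | .u _ => True
    | _ => False⟩

/-- Eve's strategy whose memory is the counter value: she descends while the counter is below `3`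
and climbs by `2`, resetting the counter, once it equals `3`. -/
def countingStrategy : StrategyA G1V (Fin 4) where
  init := 0
  update m x y := match x, y with
    | .u n, .v k => if k = n + 2 then 0 else m + 1
    | _, _ => m
  move x m := match x with
    | .u n => if m = 3 then .v (n + 2) else match n with
      | 0 => .target
      | k + 1 => .v k
    | _ => .target

theorem countingStrategy_valid : countingStrategy.Valid G1 := by
  rintro (n | n | _) m hv -
  · by_cases hm : m = 3
    · have hn : n ≠ n + 2 + 1 := by omega
      simp [countingStrategy, G1, g1Step, hm, hn]
    · cases n <;> simp [countingStrategy, G1, g1Step, hm]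
  · exact hv.elim
  · exact hv.elim

/-- A quantity that decreases at every step of a play consistent with `countingStrategy`
when `c` is the counter value. -/
def playRank (c : ℕ) : G1V → ℕ
  | .u n => 8 * n + 6 * c
  | .v n => 8 * n + 6 * c + 1
  | .target => 0

theorem untilB_of_cval_eq {π : ℕ → G1V} (hp : G1.IsPlay π)
    (hc : countingStrategy.Consistent G1 π) (k t : ℕ)
    (hmem : G1.cval π t = (countingStrategy.memAt π t).val)
    (hpeak : ∀ m, m < t →
      peakList (G1.cval π m) ((G1.step (π m) (π (m + 1))).getD []) ≤ 3)
    (hne : π t ≠ .target) (hk : playRank (G1.cval π t) (π t) ≤ k) :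
    G1.UntilB {G1V.target} 3 π := by
  induction k using Nat.strong_induction_on generalizing t with
  | _ k ih =>
  have hstep := hp t
  have hcons := hc t
  have hcv : G1.cval π (t + 1) =
    runList (G1.cval π t) ((G1.step (π t) (π (t + 1))).getD []) := rfl
  have hm : countingStrategy.memAt π (t + 1) =
    countingStrategy.update (countingStrategy.memAt π t) (π t) (π (t + 1)) := rfl
  have hlt := (countingStrategy.memAt π t).isLt
  have extend : peakList (G1.cval π t) ((G1.step (π t) (π (t + 1))).getD []) ≤ 3 →
      ∀ m, m < t + 1 →
        peakList (G1.cval π m) ((G1.step (π m) (π (m + 1))).getD []) ≤ 3 := by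
    intro h m hmt
    rcases Nat.lt_succ_iff_lt_or_eq.mp hmt with h' | rfl
    · exact hpeak m h'
    · exact h
  have continue_play (hmem' : G1.cval π (t + 1) = (countingStrategy.memAt π (t + 1)).val)
      (hpk : peakList (G1.cval π t) ((G1.step (π t) (π (t + 1))).getD []) ≤ 3)
      (hne' : π (t + 1) ≠ .target)
      (hr : playRank (G1.cval π (t + 1)) (π (t + 1)) < playRank (G1.cval π t) (π t)) :
      G1.UntilB {G1V.target} 3 π :=
    ih _ (hr.trans_le hk) (t + 1) hmem' (extend hpk) hne' le_rfl
  generalize countingStrategy.memAt π t = m at *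
  generalize countingStrategy.memAt π (t + 1) = m' at *
  generalize G1.cval π t = c at *
  generalize G1.cval π (t + 1) = c' at *
  subst hmem
  rcases hx : π t with n | n | _
  · rw [hx] at hcons hstep hcv hm extend continue_play
    have hy := hcons trivial
    by_cases h3 : m = 3
    · have hy' : π (t + 1) = .v (n + 2) := by simpa [countingStrategy, h3] using hy
      rw [hy'] at hcv hm continue_play
      subst h3
      have hn : n ≠ n + 2 + 1 := by omega
      simp [G1, g1Step, hn, runList, updC] at hcv
      simp [countingStrategy] at hm
      subst hm hcv
      apply continue_play <;> simp [G1, g1Step, hn, peakList, updC, playRank]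
      omega
    · have hm3 : m.val < 3 := by omega
      cases n with
      | zero =>
        have hy' : π (t + 1) = .target := by simpa [countingStrategy, h3] using hy
        refine ⟨t + 1, hy', extend ?_⟩
        simp [hy', G1, g1Step, peakList, updC]
        omega
      | succ n =>
        have hy' : π (t + 1) = .v n := by simpa [countingStrategy, h3] using hy
        rw [hy'] at hcv hm continue_play
        simp [G1, g1Step, runList, updC] at hcv
        have hn : n ≠ n + 1 + 2 := by omega
        simp [countingStrategy, hn] at hm
        have hv : m'.val = m.val + 1 := by omega
        subst hcv
        apply continue_play hv.symm <;> simp [G1, g1Step, peakList, updC, playRank] <;> omega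
  · rw [hx] at hstep hcv hm continue_play
    rcases hy : π (t + 1) with j | j | _
    · rw [hy] at hstep hcv hm continue_play
      have hj : n = j := by simpa [G1, g1Step] using hstep
      subst hj
      simp [G1, g1Step, runList, updC] at hcv
      simp [countingStrategy] at hm
      subst hm hcv
      apply continue_play <;> simp [G1, g1Step, peakList, updC, playRank]
      omega
    · rw [hy] at hstep hcv hm continue_play
      have hj : n = j + 1 := by simpa [G1, g1Step] using hstep
      subst hj
      simp [G1, g1Step, runList, updC] at hcv
      simp [countingStrategy] at hm
      subst hm hcv
      apply continue_play <;> simp [G1, g1Step, peakList, updC, playRank]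
      omega
    · rw [hy] at hstep
      simp [G1, g1Step] at hstep
  · exact absurd hx hne

/-- first item of Theorem 3 of the paper. In the game `G₁`,
Eve has a strategy with `4` memory states ensuring `B(3) Until F` from every
vertex `v_n`. -/
theorem statement4 :
    ∃ S : StrategyA G1V (Fin 4), S.Valid G1 ∧
      ∀ n : ℕ, EnsuresA G1 S (.v n) (G1.UntilB {G1V.target} 3) := by
  refine ⟨countingStrategy, countingStrategy_valid, fun n π h0 hp hc => ?_⟩
  exact untilB_of_cval_eq hp hc _ 0 rfl (by simp) (by simp [h0]) le_rfl
end

section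
/- In the game G₁, Eve has a strategy with 3 memory states ensuring B(4) Until F from every vertex v_n. -/
/-- The level obtained from level `a` when the vertex index decreases from `n` to `n - 1`. -/
def lowerLevel (n : ℕ) (a : Fin 3) : Fin 3 :=
  ⟨a.val - n % 2, by omega⟩

/-- Eve's strategy. In memory state `a` at index `n`, Eve intends to reset at the index
`2 * (⌈n / 2⌉ - a)` and to descend until then, so she resets when `a = 0`. -/
def levelStrategy : StrategyA G1V (Fin 3) where
  init := 0
  update a x y := match x, y with
    | .v n, .v _ => lowerLevel n a
    | .u n, .v k => if k = n + 2 then 2 else lowerLevel n a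
    | _, _ => a
  move x a := match x with
    | .u n => if a = 0 then .v (n + 2) else match n with
      | 0 => .target
      | k + 1 => .v k
    | y => y

/-- The counter bound maintained by `levelStrategy` at index `n` in memory state `a`. -/
def LevelBound (n : ℕ) (a : Fin 3) (c : ℕ) : Prop :=
  c ≤ 4 ∧ (a ≠ 0 → c + 2 * a.val ≤ 4 + n % 2)

/-- A quantity decreasing along the plays consistent with `levelStrategy`; `b` is `0` at Eve's
vertices and `1` at Adam's vertices. -/
def levelRank (n : ℕ) (a : Fin 3) (b : ℕ) : ℕ :=
  2 * n + b + 6 * ((n + 1) / 2 + 2 - a.val)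

theorem levelBound_lowerLevel {n : ℕ} {a : Fin 3} {c : ℕ} (h : LevelBound (n + 1) a c) :
    LevelBound n (lowerLevel (n + 1) a) c := by
  simp only [LevelBound, lowerLevel, ne_eq, Fin.ext_iff, Fin.val_zero] at *
  omega

theorem levelBound_lowerLevel_succ {n : ℕ} {a : Fin 3} {c : ℕ} (h : LevelBound (n + 1) a c)
    (ha : a ≠ 0) : LevelBound n (lowerLevel (n + 1) a) (c + 1) := by
  simp only [LevelBound, lowerLevel, ne_eq, Fin.ext_iff, Fin.val_zero] at *
  omega

theorem LevelBound.succ_le {n : ℕ} {a : Fin 3} {c : ℕ} (h : LevelBound n a c) (ha : a ≠ 0) :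
    c + 1 ≤ 4 := by
  simp only [LevelBound, ne_eq, Fin.ext_iff, Fin.val_zero] at *
  omega

theorem levelRank_lowerLevel_lt (n : ℕ) (a : Fin 3) (b : ℕ) :
    levelRank n (lowerLevel (n + 1) a) 1 < levelRank (n + 1) a b := by
  simp only [levelRank, lowerLevel]
  omega

theorem levelRank_reset_lt (n : ℕ) : levelRank (n + 2) 2 1 < levelRank n 0 0 := by
  simp only [levelRank, Fin.val_zero, Fin.val_two]
  omega

theorem levelStrategy_valid : levelStrategy.Valid G1 := by
  rintro (n | n | _) a hv -
  · by_cases ha : a = 0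
    · simp only [levelStrategy, G1, g1Step, ha, if_true]
      split_ifs <;> rfl
    · cases n <;> simp [levelStrategy, G1, g1Step, ha]
  · exact hv.elim
  · exact hv.elim

/-- From a position satisfying the counter bound, the rest of the play reaches the target with
counter values at most `4`. -/
theorem levelStrategy_reaches {π : ℕ → G1V} (hp : G1.IsPlay π)
    (hc : levelStrategy.Consistent G1 π) (r : ℕ) :
    ∀ (k n b : ℕ), (π k = .u n ∧ b = 0 ∨ π k = .v n ∧ b = 1) →
      LevelBound n (levelStrategy.memAt π k) (G1.cval π k) →
      levelRank n (levelStrategy.memAt π k) b = r →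
      ∃ j, π j = .target ∧ ∀ m, k ≤ m → m < j →
        peakList (G1.cval π m) ((G1.step (π m) (π (m + 1))).getD []) ≤ 4 := by
  induction r using Nat.strong_induction_on with
  | _ r ih =>
    intro k n b hb hB hr
    set a := levelStrategy.memAt π k
    set c := G1.cval π k
    have hmem : levelStrategy.memAt π (k + 1) = levelStrategy.update a (π k) (π (k + 1)) := rfl
    have hval : G1.cval π (k + 1) = runList c ((G1.step (π k) (π (k + 1))).getD []) := rfl
    -- one step of the play, followed by the induction hypothesis
    have step : ∀ n' b', (π (k + 1) = .u n' ∧ b' = 0 ∨ π (k + 1) = .v n' ∧ b' = 1) →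
        peakList c ((G1.step (π k) (π (k + 1))).getD []) ≤ 4 →
        LevelBound n' (levelStrategy.memAt π (k + 1)) (G1.cval π (k + 1)) →
        levelRank n' (levelStrategy.memAt π (k + 1)) b' < r →
        ∃ j, π j = .target ∧ ∀ m, k ≤ m → m < j →
          peakList (G1.cval π m) ((G1.step (π m) (π (m + 1))).getD []) ≤ 4 := by
      intro n' b' hb' hpk hB' hlt
      obtain ⟨j, hj, hjm⟩ := ih _ hlt (k + 1) n' b' hb' hB' rfl
      refine ⟨j, hj, fun m hkm hmj => ?_⟩
      rcases hkm.eq_or_lt with rfl | hkm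
      · exact hpk
      · exact hjm m hkm hmj
    rcases hb with ⟨hu, rfl⟩ | ⟨hv, rfl⟩
    · have hmove : π (k + 1) = levelStrategy.move (π k) a := hc k (by rw [hu]; trivial)
      by_cases ha : a = 0
      · have hnext : π (k + 1) = .v (n + 2) := by
          rw [hmove, hu]
          simp [levelStrategy, ha]
        have hm : levelStrategy.memAt π (k + 1) = 2 := by
          rw [hmem, hu, hnext]
          simp [levelStrategy]
        have hs : G1.step (.u n) (.v (n + 2)) = some [.reset] := by
          simp [G1, g1Step]
          omega
        apply step (n + 2) 1 (Or.inr ⟨hnext, rfl⟩)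
        · rw [hu, hnext, hs]
          simpa [peakList, updC] using hB.1
        · rw [hm, hval, hu, hnext, hs]
          simp [LevelBound, runList, updC]
        · rw [hm, ← hr, ha]
          exact levelRank_reset_lt n
      · have hc4 := hB.succ_le ha
        cases n with
        | zero =>
          have hnext : π (k + 1) = .target := by
            rw [hmove, hu]
            simp [levelStrategy, ha]
          refine ⟨k + 1, hnext, fun m hkm hmk => ?_⟩
          obtain rfl : m = k := by omega
          have hs : G1.step (.u 0) .target = some [.inc] := rfl
          rw [hu, hnext, hs]
          simpa [peakList, updC] using hc4
        | succ n =>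
          have hnext : π (k + 1) = .v n := by
            rw [hmove, hu]
            simp [levelStrategy, ha]
          have hm : levelStrategy.memAt π (k + 1) = lowerLevel (n + 1) a := by
            rw [hmem, hu, hnext]
            simp [levelStrategy]
            omega
          have hs : G1.step (.u (n + 1)) (.v n) = some [.inc] := by
            simp [G1, g1Step]
          apply step n 1 (Or.inr ⟨hnext, rfl⟩)
          · rw [hu, hnext, hs]
            simpa [peakList, updC] using hc4
          · rw [hm, hval, hu, hnext, hs]
            exact levelBound_lowerLevel_succ hB ha
          · rw [hm, ← hr]
            exact levelRank_lowerLevel_lt n a 0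
    · have hplay := hp k
      rw [hv] at hplay
      cases hnext : π (k + 1) with
      | u n' =>
        obtain rfl : n = n' := by
          by_contra h
          simp [hnext, G1, g1Step, h] at hplay
        have hm : levelStrategy.memAt π (k + 1) = a := by
          rw [hmem, hv, hnext]
          rfl
        have hs : G1.step (.v n) (.u n) = some [.eps] := by
          simp [G1, g1Step]
        apply step n 0 (Or.inl ⟨hnext, rfl⟩)
        · rw [hv, hnext, hs]
          simpa [peakList, updC] using hB.1
        · rw [hm, hval, hv, hnext, hs]
          exact hB
        · rw [hm, ← hr]
          simp only [levelRank]
          omega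
      | v n' =>
        obtain rfl : n = n' + 1 := by
          by_contra h
          simp [hnext, G1, g1Step, h] at hplay
        have hm : levelStrategy.memAt π (k + 1) = lowerLevel (n' + 1) a := by
          rw [hmem, hv, hnext]
          rfl
        have hs : G1.step (.v (n' + 1)) (.v n') = some [.eps] := by
          simp [G1, g1Step]
        apply step n' 1 (Or.inr ⟨hnext, rfl⟩)
        · rw [hv, hnext, hs]
          simpa [peakList, updC] using hB.1
        · rw [hm, hval, hv, hnext, hs]
          exact levelBound_lowerLevel hB
        · rw [hm, ← hr]
          exact levelRank_lowerLevel_lt n' a 1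
      | target => simp [hnext, G1, g1Step] at hplay

/-- second item of Theorem 3 of the paper. In the game `G₁`,
Eve has a strategy with `3` memory states ensuring `B(4) Until F` from every
vertex `v_n`. -/
theorem statement5 :
    ∃ S : StrategyA G1V (Fin 3), S.Valid G1 ∧
      ∀ n : ℕ, EnsuresA G1 S (.v n) (G1.UntilB {G1V.target} 4) := by
  refine ⟨levelStrategy, levelStrategy_valid, fun n π h0 hp hc => ?_⟩
  obtain ⟨j, hj, hjm⟩ := levelStrategy_reaches hp hc _ 0 n 1 (Or.inr ⟨h0, rfl⟩)
    ⟨Nat.zero_le 4, fun h => absurd rfl h⟩ rfl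
  exact ⟨j, hj, fun m hm => hjm m m.zero_le hm⟩
end

section
/- For all K and N, there exists a finite B-reachability game with one counter and a target set F such that Eve has a strategy with 3^K memory states ensuring B(K(K+3)) Until F, but no strategy of Eve with K+1 memory states ensures B(N) Until F. In particular, there is no trade-off function between bounds and memory for B-reachability games over finite arenas: no pair of functions mem: ℕ → ℕ and α: ℕ → ℕ can guarantee, for every finite B-reachability game with one counter, a strategy with mem-many memory states ensuring the bound α applied to the optimal bound. -/
section Runs

variable {V M : Type}

/-- One step of a play consistent with `S`, on triples (vertex, memory state, counter value). -/
def StrategyA.Step (G : GameA V) (S : StrategyA V M) (a b : V × M × ℕ) : Prop :=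
  (G.step a.1 b.1).isSome ∧ (G.eve a.1 → b.1 = S.move a.1 a.2.1) ∧
    b.2.1 = S.update a.2.1 a.1 b.1 ∧ b.2.2 = runList a.2.2 ((G.step a.1 b.1).getD [])

/-- The configurations all of whose continuations consistent with `S` satisfy
`B(N) Until F`, as an inductive predicate. -/
inductive StrategyA.Wins (G : GameA V) (S : StrategyA V M) (F : Set V) (N : ℕ) :
    V × M × ℕ → Prop
  | target (a : V × M × ℕ) : a.1 ∈ F → StrategyA.Wins G S F N a
  | next (a : V × M × ℕ) :
      (∀ b, S.Step G a b → peakList a.2.2 ((G.step a.1 b.1).getD []) ≤ N) →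
      (∀ b, S.Step G a b → StrategyA.Wins G S F N b) → StrategyA.Wins G S F N a

theorem StrategyA.wins_of_ensures {G : GameA V} {S : StrategyA V M} {F : Set V} {N : ℕ} {v₀ : V}
    (serial : ∀ a, ∃ b, S.Step G a b) (h : EnsuresA G S v₀ (G.UntilB F N)) :
    S.Wins G F N (v₀, S.init, 0) := by
  classical
  by_contra hw
  have hnext : ∀ a, ∃ b, S.Step G a b ∧ (¬ S.Wins G F N a →
      peakList a.2.2 ((G.step a.1 b.1).getD []) ≤ N → ¬ S.Wins G F N b) := by
    intro a
    by_contra! hc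
    obtain ⟨b, hb⟩ := serial a
    have ha := (hc b hb).1
    refine ha (.next a (fun b hb => (hc b hb).2.1) (fun b hb => (hc b hb).2.2))
  choose f hf hf' using hnext
  set g : ℕ → V × M × ℕ := fun n => f^[n] (v₀, S.init, 0) with hg
  have hsucc : ∀ n, g (n + 1) = f (g n) := fun n => Function.iterate_succ_apply' f n _
  have hstep : ∀ n, S.Step G (g n) (g (n + 1)) := fun n => by rw [hsucc]; exact hf _
  have hmem : ∀ n, S.memAt (fun n => (g n).1) n = (g n).2.1 := by
    intro n
    induction n with
    | zero => rfl
    | succ n ih => rw [StrategyA.memAt, ih, (hstep n).2.2.1]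
  have hval : ∀ n, G.cval (fun n => (g n).1) n = (g n).2.2 := by
    intro n
    induction n with
    | zero => rfl
    | succ n ih => rw [GameA.cval, ih, (hstep n).2.2.2]
  obtain ⟨n, hn, hpeak⟩ := h (fun n => (g n).1) rfl (fun n => (hstep n).1)
    (fun n he => by rw [hmem]; exact (hstep n).2.1 he)
  have hlose : ∀ m, m ≤ n → ¬ S.Wins G F N (g m) := by
    intro m
    induction m with
    | zero => exact fun _ => hw
    | succ m ih =>
      intro hm
      have hp := hpeak m hm
      simp only [hval, hsucc] at hp
      rw [hsucc]
      exact hf' _ (ih (by omega)) hp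
  exact hlose n le_rfl (.target _ hn)

end Runs

theorem le_peakList (c : ℕ) (l : List CAct) : c ≤ peakList c l := by
  cases l <;> simp [peakList]

/-- Vertices of the ladder game: Adam picks an option `k` at the level `x`, Eve answers it by
an increment (`true`) or a reset (`false`), and then Adam picks the next level. -/
inductive Ladder (n K : ℕ) : Type
  | lev (x : Fin n)
  | opt (x : Fin n) (k : Fin (K + 1))
  | res (x : Fin n) (k : Fin (K + 1)) (b : Bool)
  | tgt

namespace Ladder

instance (n K : ℕ) : Finite (Ladder n K) := by
  let f : Ladder n K → Option (Fin n × Option (Fin (K + 1) × Option Bool))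
    | lev x => some (x, none)
    | opt x k => some (x, some (k, none))
    | res x k b => some (x, some (k, some b))
    | tgt => none
  refine Finite.of_injective f ?_
  rintro (_ | _ | _ | _) (_ | _ | _ | _) <;> simp +contextual [f]

/-- In the ladder game, levels are read in base `L`. An answer to the option `k` lets Adam change
the digits of index less than `k` at will; the number formed by the other digits may not
increase, and has to decrease if the answer is an increment. -/
def game (L K : ℕ) : GameA (Ladder (L ^ (K + 1)) K) where
  step
    | lev x, opt y _ => if x = y then some [] else none
    | opt x k, res y j b => if x = y ∧ k = j then some [cond b .inc .reset] else none
    | res x k b, lev y =>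
        if (y : ℕ) / L ^ (k : ℕ) + b.toNat ≤ (x : ℕ) / L ^ (k : ℕ) then some [] else none
    | res _ _ _, tgt => some []
    | tgt, tgt => some []
    | _, _ => none
  eve
    | opt _ _ => True
    | _ => False

section Upper

variable {L K : ℕ}

/-- Eve's strategy storing the counter value `c`: increment on the options `k ≥ c`, reset on
the others. -/
def counting (L K B : ℕ) (hB : K + 1 < B) : StrategyA (Ladder (L ^ (K + 1)) K) (Fin B) where
  init := ⟨0, by omega⟩
  update m _ v := match v with
    | res _ _ true => ⟨min (m + 1) (K + 1), by omega⟩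
    | res _ _ false => ⟨0, by omega⟩
    | _ => m
  move v m := match v with
    | opt x k => res x k (decide ((m : ℕ) ≤ k))
    | _ => tgt

/-- Measure decreasing between successive visits of levels when Eve plays `counting`. -/
def rank (L x c : ℕ) : ℕ := 2 * ((x / L ^ (c - 1) + 1) * L ^ (c - 1)) + if c = 0 then 0 else 1

theorem div_pow_mono {L x y k j : ℕ} (hkj : k ≤ j) (h : y / L ^ k ≤ x / L ^ k) :
    y / L ^ j ≤ x / L ^ j := by
  obtain ⟨d, rfl⟩ := Nat.exists_eq_add_of_le hkj
  rw [pow_add, ← Nat.div_div_eq_div_mul, ← Nat.div_div_eq_div_mul]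
  exact Nat.div_le_div_right h

theorem rank_inc {L x y c k : ℕ} (hL : 0 < L) (hck : c ≤ k) (h : y / L ^ k + 1 ≤ x / L ^ k) :
    rank L y (c + 1) < rank L x c := by
  have h1 : y / L ^ c + 1 ≤ x / L ^ c := by
    by_contra hc
    have := div_pow_mono hck (show x / L ^ c ≤ y / L ^ c by omega)
    omega
  have h2 := Nat.mul_le_mul_right (L ^ c) h1
  have h3 := Nat.div_mul_le_self x (L ^ c)
  have h4 := Nat.lt_mul_of_div_lt (Nat.lt_succ_self (x / L ^ (c - 1))) (pow_pos hL (c - 1))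
  simp only [rank, Nat.add_sub_cancel, Nat.succ_eq_add_one] at *
  split_ifs <;> omega

theorem rank_reset {L x y c k : ℕ} (hL : 0 < L) (hkc : k < c) (h : y / L ^ k ≤ x / L ^ k) :
    rank L y 0 < rank L x c := by
  have h1 := div_pow_mono (show k ≤ c - 1 by omega) h
  have h4 := Nat.lt_mul_of_div_lt (Nat.lt_succ_of_le h1) (pow_pos hL (c - 1))
  simp only [rank, Nat.succ_eq_add_one] at *
  rw [if_neg (by omega : c ≠ 0)]
  simp
  omega

theorem counting_valid (B : ℕ) (hB : K + 1 < B) : (counting L K B hB).Valid (game L K) := by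
  rintro (_ | _ | _ | _) m hv - <;> simp_all [game, counting]

/-- Under `counting` the memory state remains equal to the counter value, which remains at most
`K + 1`. -/
theorem counting_step (B : ℕ) (hB : K + 1 < B) {m : Fin B} {c : ℕ}
    {v w : Ladder (L ^ (K + 1)) K} (hmc : (m : ℕ) = c) (hcK : c ≤ K + 1)
    (hp : ((game L K).step v w).isSome)
    (hc : (game L K).eve v → w = (counting L K B hB).move v m) :
    peakList c (((game L K).step v w).getD []) ≤ K + 1 ∧
      ((counting L K B hB).update m v w : ℕ) = runList c (((game L K).step v w).getD []) ∧
      runList c (((game L K).step v w).getD []) ≤ K + 1 := by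
  subst hmc
  rcases v with x | ⟨x, k⟩ | ⟨x, k, b⟩ | _ <;> rcases w with y | ⟨y, j⟩ | ⟨y, j, d⟩ | _ <;>
    simp [game] at hp hc ⊢
  · subst hp; simp [peakList, runList, counting, hcK]
  · obtain ⟨rfl, rfl⟩ := hp
    have hk := k.isLt
    simp [counting] at hc
    subst hc
    by_cases hmk : (m : ℕ) ≤ k
    · simp [hmk, peakList, runList, updC, counting]
      omega
    · simp [hmk, peakList, runList, updC, counting]
      omega
  · simp [hp, peakList, runList, counting, hcK]
  · simp [peakList, runList, counting, hcK]
  · simp [peakList, runList, counting, hcK]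

theorem counting_ensures (B : ℕ) (hB : K + 1 < B) (hL : 0 < L) (x₀ : Fin (L ^ (K + 1))) :
    EnsuresA (game L K) (counting L K B hB) (lev x₀)
      ((game L K).UntilB {tgt} (K + 1)) := by
  intro π h0 hplay hcons
  set S := counting L K B hB with hS
  have hinv : ∀ n, ((S.memAt π n : Fin B) : ℕ) = (game L K).cval π n ∧
      (game L K).cval π n ≤ K + 1 := by
    intro n
    induction n with
    | zero => exact ⟨rfl, Nat.zero_le _⟩
    | succ n ih => exact (counting_step B hB ih.1 ih.2 (hplay n) (hcons n)).2
  have hreach : ∃ n, π n = tgt := by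
    by_contra! hne
    have hrank : ∀ n, ∃ x, π (3 * n) = lev x ∧
        rank L x (S.memAt π (3 * n)) + n ≤ rank L x₀ 0 := by
      intro n
      induction n with
      | zero => exact ⟨x₀, h0, le_rfl⟩
      | succ n ih =>
        obtain ⟨x, hx, hr⟩ := ih
        have hp0 := hplay (3 * n)
        have hp1 := hplay (3 * n + 1)
        have hp2 := hplay (3 * n + 2)
        have hc1 := hcons (3 * n + 1)
        have hne3 := hne (3 * n + 3)
        have e1 : S.memAt π (3 * n + 1) =
          S.update (S.memAt π (3 * n)) (π (3 * n)) (π (3 * n + 1)) := rfl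
        have e2 : S.memAt π (3 * n + 2) =
          S.update (S.memAt π (3 * n + 1)) (π (3 * n + 1)) (π (3 * n + 2)) := rfl
        have e3 : S.memAt π (3 * n + 3) =
          S.update (S.memAt π (3 * n + 2)) (π (3 * n + 2)) (π (3 * n + 3)) := rfl
        rw [show 3 * (n + 1) = 3 * n + 3 by ring]
        simp only [show 3 * n + 1 + 1 = 3 * n + 2 by ring,
          show 3 * n + 2 + 1 = 3 * n + 3 by ring] at *
        rw [e3]
        rw [e1] at e2 hc1
        rw [e2]
        clear e1 e2 e3 hinv hplay hcons
        generalize S.memAt π (3 * n) = m at *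
        generalize π (3 * n) = v0 at *
        generalize π (3 * n + 1) = v1 at *
        generalize π (3 * n + 2) = v2 at *
        generalize π (3 * n + 3) = v3 at *
        subst hx
        rcases v1 with y | ⟨y, k⟩ | ⟨y, k, b⟩ | _ <;> simp [game] at hp0
        subst hp0
        rcases v2 with y | ⟨y, j⟩ | ⟨y, j, d⟩ | _ <;> simp [game] at hp1
        obtain ⟨rfl, rfl⟩ := hp1
        rcases v3 with z | ⟨z, j⟩ | ⟨z, j, d'⟩ | _ <;> simp [game] at hp2 hne3
        refine ⟨z, rfl, ?_⟩
        have hk := k.isLt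
        simp [game, hS, counting] at hc1
        subst hc1
        by_cases hmk : (m : ℕ) ≤ k
        · simp [hmk] at hp2
          have := rank_inc hL hmk hp2
          simp [hmk, hS, counting]
          rw [min_eq_left (by omega)]
          omega
        · simp [hmk] at hp2
          have := rank_reset hL (by omega : (k : ℕ) < m) hp2
          simp [hmk, hS, counting]
          omega
    obtain ⟨x, -, hx⟩ := hrank (rank L x₀ 0 + 1)
    omega
  obtain ⟨n, hn⟩ := hreach
  exact ⟨n, hn, fun m _ =>
    (counting_step B hB (hinv m).1 (hinv m).2 (hplay m) (hcons m)).1⟩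

end Upper

section Lower

variable {M : Type} {L K N : ℕ}

/-- One round of the ladder game against fixed answers `act` and memory updates `upd`. -/
def Round (L K : ℕ) (act : Fin (L ^ (K + 1)) → Fin (K + 1) → M → Bool)
    (upd : Fin (L ^ (K + 1)) → Fin (K + 1) → Fin (L ^ (K + 1)) → M → M)
    (a b : Fin (L ^ (K + 1)) × M × ℕ) : Prop :=
  ∃ k : Fin (K + 1), (b.1 : ℕ) / L ^ (k : ℕ) + (act a.1 k a.2.1).toNat ≤ (a.1 : ℕ) / L ^ (k : ℕ) ∧
    b.2.1 = upd a.1 k b.1 a.2.1 ∧ b.2.2 = if act a.1 k a.2.1 then a.2.2 + 1 else 0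

/-- Configurations from which the number of rounds is finite and the counter stays at most `N`. -/
inductive Bounded {C : Type} (R : C → C → Prop) (val : C → ℕ) (N : ℕ) : C → Prop
  | intro (a : C) : val a ≤ N → (∀ b, R a b → Bounded R val N b) → Bounded R val N a

namespace Bounded

variable {C : Type} {R : C → C → Prop} {val : C → ℕ} {a b : C}

theorem val_le (h : Bounded R val N a) : val a ≤ N := by
  cases h; assumption

theorem of_rel (h : Bounded R val N a) (hab : R a b) : Bounded R val N b := by
  cases h with
  | intro _ _ h => exact h b hab

theorem of_reflTransGen (h : Bounded R val N a) (hab : Relation.ReflTransGen R a b) :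
    Bounded R val N b := by
  induction hab with
  | refl => exact h
  | tail _ hbc ih => exact ih.of_rel hbc

theorem acc_transGen (h : Bounded R val N a) :
    Acc (fun x y => Relation.TransGen R y x) a := by
  have : Acc (fun x y => R y x) a := by
    induction h with
    | intro a _ _ ih => exact ⟨a, fun b hb => ih b hb⟩
  have hswap : (fun x y => Relation.TransGen R y x) = Relation.TransGen (fun x y => R y x) := by
    ext x y
    exact Relation.transGen_swap.symm
  exact hswap ▸ this.transGen

end Bounded

variable {act : Fin (L ^ (K + 1)) → Fin (K + 1) → M → Bool}
  {upd : Fin (L ^ (K + 1)) → Fin (K + 1) → Fin (L ^ (K + 1)) → M → M}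

open Relation in
/-- Restricting to the options of index less than `k`, Adam can leave any family of sets of at
most `k` memory states while changing only the digits of index less than `k`. -/
theorem exists_escape (hL : L = N + 3) (k : ℕ) (hk : k ≤ K + 1)
    (A : Fin (L ^ (K + 1)) → Finset M) (hA : ∀ y, (A y).card ≤ k) (q : ℕ)
    (a : Fin (L ^ (K + 1)) × M × ℕ) (ha : (a.1 : ℕ) + 1 = (q + 1) * L ^ k)
    (hb : Bounded (Round L K act upd) (fun a => a.2.2) N a) :
    ∃ b, ReflTransGen (Round L K act upd) a b ∧ (b.1 : ℕ) / L ^ k = q ∧ b.2.1 ∉ A b.1 := by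
  classical
  induction k generalizing A q a with
  | zero =>
    refine ⟨a, .refl, ?_, ?_⟩
    · simp at ha ⊢; exact ha
    · rw [Finset.card_eq_zero.1 (Nat.le_zero.1 (hA a.1))]; simp
  | succ k ih =>
    have hLk : 0 < L ^ k := pow_pos (by omega) k
    let κ : Fin (K + 1) := ⟨k, by omega⟩
    have trap : ∀ p : ℕ, (∀ y : Fin (L ^ (K + 1)), (y : ℕ) / L ^ k = p →
        ∃ s ∈ A y, act y κ s = false) →
        ∀ a, (a.1 : ℕ) + 1 = (p + 1) * L ^ k →
        Bounded (Round L K act upd) (fun a => a.2.2) N a →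
        ∃ b, ReflTransGen (Round L K act upd) a b ∧ (b.1 : ℕ) / L ^ k = p ∧ b.2.1 ∉ A b.1 := by
      intro p hp a ha hb
      induction hb.acc_transGen with
      | intro a _ iha =>
        obtain ⟨b, hab, hbp, hbA⟩ := ih (by omega)
          (fun y => if (y : ℕ) / L ^ k = p then {s ∈ A y | act y κ s = true} else ∅)
          (fun y => by
            split_ifs with hy
            · obtain ⟨s, hs, hsa⟩ := hp y hy
              have : ({s ∈ A y | act y κ s = true} : Finset M).card < (A y).card :=
                Finset.card_lt_card (Finset.filter_ssubset.2 ⟨s, hs, by simp [hsa]⟩)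
              have := hA y
              omega
            · simp) p a ha hb
        by_cases hbA' : b.2.1 ∈ A b.1
        · have hact : act b.1 κ b.2.1 = false := by
            simpa [hbp, hbA'] using hbA
          have hap : (a.1 : ℕ) / L ^ k = p := by
            rw [show (a.1 : ℕ) = (L ^ k - 1) + L ^ k * p by
              have : (p + 1) * L ^ k = L ^ k * p + L ^ k := by ring
              omega, Nat.add_mul_div_left _ _ hLk, Nat.div_eq_of_lt (by omega), zero_add]
          have hstep : Round L K act upd b (a.1, upd b.1 κ a.1 b.2.1, 0) :=
            ⟨κ, by simp [hact, κ, hap, hbp], rfl, by simp [hact]⟩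
          obtain ⟨d, hd⟩ := iha _ (TransGen.tail' hab hstep) ha
            ((hb.of_reflTransGen hab).of_rel hstep)
          exact ⟨d, (hab.tail hstep).trans hd.1, hd.2⟩
        · exact ⟨b, hab, hbp, hbA'⟩
    by_contra! H
    have hdiv : ∀ y j, j < L → y / L ^ k = q * L + j → y / L ^ (k + 1) = q := by
      intro y j hj hy
      rw [pow_succ, ← Nat.div_div_eq_div_mul, hy, mul_comm q L, Nat.mul_add_div (by omega),
        Nat.div_eq_of_lt hj, add_zero]
    have hpow : (q + 1) * L ^ (k + 1) = (q * L + (N + 2) + 1) * L ^ k := by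
      rw [pow_succ, hL]; ring
    have good : ∀ e, ReflTransGen (Round L K act upd) a e → ∀ j, j < L →
        q * L + j + (act e.1 κ e.2.1).toNat ≤ (e.1 : ℕ) / L ^ k →
        ∃ y : Fin (L ^ (K + 1)), (y : ℕ) / L ^ k = q * L + j ∧
          (∀ s ∈ A y, act y κ s = true) ∧
          ReflTransGen (Round L K act upd) a
            (y, upd e.1 κ y e.2.1, if act e.1 κ e.2.1 then e.2.2 + 1 else 0) := by
      intro e hae j hj hje
      have hround : ∀ y : Fin (L ^ (K + 1)), (y : ℕ) / L ^ k = q * L + j →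
          ReflTransGen (Round L K act upd) a
            (y, upd e.1 κ y e.2.1, if act e.1 κ e.2.1 then e.2.2 + 1 else 0) :=
        fun y hy => hae.tail ⟨κ, by simpa [κ, hy] using hje, rfl, rfl⟩
      by_contra! hno
      have htrap := trap (q * L + j) (fun y hy => by
        by_contra! hy'
        exact hno y hy (fun s hs => by simpa using hy' s hs) (hround y hy))
      have hle : (q * L + j + 1) * L ^ k ≤ (a.1 : ℕ) + 1 := by
        rw [ha, hpow]
        exact Nat.mul_le_mul_right _ (by omega)
      have hpos : 0 < (q * L + j + 1) * L ^ k := by positivity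
      let y : Fin (L ^ (K + 1)) := ⟨(q * L + j + 1) * L ^ k - 1, by have := a.1.isLt; omega⟩
      have hy : (y : ℕ) + 1 = (q * L + j + 1) * L ^ k := by simp only [y]; omega
      have hyj : (y : ℕ) / L ^ k = q * L + j := by
        rw [show (y : ℕ) = (L ^ k - 1) + L ^ k * (q * L + j) by
          have : (q * L + j + 1) * L ^ k = L ^ k * (q * L + j) + L ^ k := by ring
          omega, Nat.add_mul_div_left _ _ hLk, Nat.div_eq_of_lt (by omega), zero_add]
      obtain ⟨d, hd, hdj, hdA⟩ := htrap _ hy (hb.of_reflTransGen (hround y hyj))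
      exact hdA (H d ((hround y hyj).trans hd) (hdiv _ j hj hdj))
    have climb : ∀ j, j ≤ N + 1 → ∃ e, ReflTransGen (Round L K act upd) a e ∧
        (e.1 : ℕ) / L ^ k = q * L + (N + 1 - j) ∧ (∀ s ∈ A e.1, act e.1 κ s = true) ∧
        j ≤ e.2.2 := by
      intro j
      induction j with
      | zero =>
        intro _
        have hadiv : (a.1 : ℕ) / L ^ k = q * L + (N + 2) := by
          rw [show (a.1 : ℕ) = (L ^ k - 1) + L ^ k * (q * L + (N + 2)) by
            have : (q * L + (N + 2) + 1) * L ^ k = L ^ k * (q * L + (N + 2)) + L ^ k := by ring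
            omega, Nat.add_mul_div_left _ _ hLk, Nat.div_eq_of_lt (by omega), zero_add]
        obtain ⟨y, hy, hyA, hay⟩ := good a .refl (N + 1) (by omega) (by
          have := Bool.toNat_le (act a.1 κ a.2.1)
          omega)
        exact ⟨_, hay, hy, hyA, Nat.zero_le _⟩
      | succ j ihj =>
        intro hj
        obtain ⟨e, hae, hej, heA, hec⟩ := ihj (by omega)
        have hact := heA _ (H e hae (hdiv _ _ (by omega) hej))
        obtain ⟨y, hy, hyA, hay⟩ := good e hae (N + 1 - (j + 1)) (by omega) (by
          simp only [hact, Bool.toNat_true]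
          omega)
        exact ⟨_, hay, hy, hyA, by simp [hact, hec]⟩
    obtain ⟨e, hae, -, -, hec⟩ := climb (N + 1) le_rfl
    have := (hb.of_reflTransGen hae).val_le
    omega

theorem not_ensures [Fintype M] (hM : Fintype.card M ≤ K + 1) (hL : L = N + 3)
    (x₀ : Fin (L ^ (K + 1))) (hx₀ : (x₀ : ℕ) + 1 = L ^ (K + 1))
    (S : StrategyA (Ladder (L ^ (K + 1)) K) M) (hS : S.Valid (game L K)) :
    ¬ EnsuresA (game L K) S (lev x₀) ((game L K).UntilB {tgt} N) := by
  intro hens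
  have hmove : ∀ x k s, ∃ b, S.move (opt x k) s = res x k b := by
    intro x k s
    have h := hS (opt x k) s trivial ⟨res x k true, by simp [game]⟩
    rcases hv : S.move (opt x k) s with y | ⟨y, j⟩ | ⟨y, j, d⟩ | _ <;> simp [game, hv] at h
    obtain ⟨rfl, rfl⟩ := h
    exact ⟨d, rfl⟩
  choose ans hans using hmove
  have hw := StrategyA.wins_of_ensures (fun a => by
    obtain ⟨v, s, c⟩ := a
    suffices h : ∃ w, ((game L K).step v w).isSome ∧ ((game L K).eve v → w = S.move v s) from
      h.elim fun w hw => ⟨(w, S.update s v w, runList c (((game L K).step v w).getD [])),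
        hw.1, hw.2, rfl, rfl⟩
    rcases v with x | ⟨x, k⟩ | ⟨x, k, b⟩ | _
    · exact ⟨opt x 0, by simp [game]⟩
    · exact ⟨res x k (ans x k s), by simp [game, hans]⟩
    · exact ⟨tgt, by simp [game]⟩
    · exact ⟨tgt, by simp [game]⟩) hens
  let act : Fin (L ^ (K + 1)) → Fin (K + 1) → M → Bool :=
    fun x k s => ans x k (S.update s (lev x) (opt x k))
  let upd₂ : Fin (L ^ (K + 1)) → Fin (K + 1) → Fin (L ^ (K + 1)) → M → M :=
    fun x k y s => S.update (S.update s (opt x k) (res x k (ans x k s)))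
      (res x k (ans x k s)) (lev y)
  let upd : Fin (L ^ (K + 1)) → Fin (K + 1) → Fin (L ^ (K + 1)) → M → M :=
    fun x k y s => upd₂ x k y (S.update s (lev x) (opt x k))
  let Good : Ladder (L ^ (K + 1)) K × M × ℕ → Prop := fun a => match a with
    | (lev x, s, c) => Bounded (Round L K act upd) (fun a => a.2.2) N (x, s, c)
    | (opt x k, s, c) => c ≤ N ∧ ∀ y : Fin (L ^ (K + 1)),
        (y : ℕ) / L ^ (k : ℕ) + (ans x k s).toNat ≤ (x : ℕ) / L ^ (k : ℕ) →
        Bounded (Round L K act upd) (fun a => a.2.2) N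
          (y, upd₂ x k y s, if ans x k s then c + 1 else 0)
    | (res x k b, s, c) => ∀ y : Fin (L ^ (K + 1)),
        (y : ℕ) / L ^ (k : ℕ) + b.toNat ≤ (x : ℕ) / L ^ (k : ℕ) →
        Bounded (Round L K act upd) (fun a => a.2.2) N (y, S.update s (res x k b) (lev y), c)
    | (tgt, _, _) => True
  have hgood : ∀ a, S.Wins (game L K) {tgt} N a → Good a := by
    intro a ha
    induction ha with
    | target a ha =>
      obtain ⟨v, s, c⟩ := a
      obtain rfl : v = tgt := ha
      trivial
    | next a hpeak _ ih =>
      obtain ⟨v, s, c⟩ := a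
      rcases v with x | ⟨x, k⟩ | ⟨x, k, b⟩ | _
      · have hstep : ∀ k, S.Step (game L K) (lev x, s, c)
            (opt x k, S.update s (lev x) (opt x k), c) :=
          fun k => ⟨by simp [game], by simp [game], rfl, by simp [game, runList]⟩
        refine .intro _ ((le_peakList _ _).trans (hpeak _ (hstep 0))) ?_
        rintro ⟨y, s', c'⟩ ⟨k, hk, hs', hc'⟩
        dsimp only at hs' hc'
        subst hs' hc'
        exact (ih _ (hstep k)).2 y hk
      · have hstep : S.Step (game L K) (opt x k, s, c)
            (res x k (ans x k s), S.update s (opt x k) (res x k (ans x k s)),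
              if ans x k s then c + 1 else 0) :=
          ⟨by simp [game], fun _ => (hans x k s).symm, rfl, by
            cases h : ans x k s <;> simp [game, runList, updC]⟩
        exact ⟨(le_peakList _ _).trans (hpeak _ hstep), fun y hy => ih _ hstep y hy⟩
      · intro y hy
        exact ih (lev y, S.update s (res x k b) (lev y), c)
          ⟨by simp [game, hy], by simp [game], rfl, by simp [game, hy, runList]⟩
      · trivial
  obtain ⟨b, -, -, hb⟩ := exists_escape hL (K + 1) le_rfl (fun _ => Finset.univ)
    (fun _ => by simpa using hM) 0 (x₀, S.init, 0) (by simpa using hx₀) (hgood _ hw)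
  exact hb (Finset.mem_univ _)

end Lower

end Ladder

/-- The ladder game with suitable parameters separates memory `3 ^ K` from memory at most
`K + 1`. -/
theorem exists_game_separating_memory (K N : ℕ) (hK : 1 ≤ K) :
    ∃ (V : Type) (_ : Finite V) (G : GameA V) (F : Set V) (v₀ : V),
      (∃ S : StrategyA V (Fin (3 ^ K)), S.Valid G ∧
        EnsuresA G S v₀ (G.UntilB F (K * (K + 3)))) ∧
      (∀ (M : Type) [Fintype M], Fintype.card M ≤ K + 1 →
        ∀ S : StrategyA V M, S.Valid G → ¬ EnsuresA G S v₀ (G.UntilB F N)) := by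
  have hB : K + 1 < 3 ^ K := by
    induction K, hK using Nat.le_induction with
    | base => norm_num
    | succ K _ ih => rw [pow_succ]; omega
  have hpos : 0 < (N + 3) ^ (K + 1) := by positivity
  let x₀ : Fin ((N + 3) ^ (K + 1)) := ⟨(N + 3) ^ (K + 1) - 1, by omega⟩
  refine ⟨_, inferInstance, Ladder.game (N + 3) K, {Ladder.tgt}, Ladder.lev x₀,
    ⟨Ladder.counting (N + 3) K _ hB, Ladder.counting_valid _ hB, ?_⟩, ?_⟩
  · intro π h0 hplay hcons
    obtain ⟨n, hn, hle⟩ := Ladder.counting_ensures _ hB (by omega) x₀ π h0 hplay hcons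
    exact ⟨n, hn, fun m hm => (hle m hm).trans (by nlinarith)⟩
  · intro M _ hM S hS
    exact Ladder.not_ensures hM rfl x₀ (by simp only [x₀]; omega) S hS

/-- Theorem 2 of the paper: there is no trade-off between
bounds and memory over finite arenas.

First part: for all `K ≥ 1` and `N`, there is a finite B-reachability game
with one counter and a target set `F` such that Eve has a strategy with `3^K`
memory states ensuring `B(K(K+3)) Until F`, but no strategy of Eve with `K+1`
memory states ensures `B(N) Until F`.

Second part: there is no pair of functions `mem : ℕ → ℕ` and `α : ℕ → ℕ`
such that every finite B-reachability game with one counter in which Eve can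
ensure `B(N) Until F` (i.e. whose optimal bound is at most `N`) admits a
strategy of Eve with `mem 1` memory states (`1` being the number of counters)
ensuring `B(α N) Until F`. -/
theorem statement9 :
    (∀ K N : ℕ, 1 ≤ K →
      ∃ (V : Type) (_ : Finite V) (G : GameA V) (F : Set V) (v₀ : V),
        (∃ S : StrategyA V (Fin (3 ^ K)), S.Valid G ∧
          EnsuresA G S v₀ (G.UntilB F (K * (K + 3)))) ∧
        (∀ (M : Type) [Fintype M], Fintype.card M = K + 1 →
          ∀ S : StrategyA V M, S.Valid G → ¬ EnsuresA G S v₀ (G.UntilB F N))) ∧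
    ¬ ∃ (mem : ℕ → ℕ) (α : ℕ → ℕ),
        ∀ (V : Type), Finite V → ∀ (G : GameA V) (F : Set V) (v₀ : V) (N : ℕ),
          (∃ (M : Type) (S : StrategyA V M), S.Valid G ∧
            EnsuresA G S v₀ (G.UntilB F N)) →
          ∃ S : StrategyA V (Fin (mem 1)), S.Valid G ∧
            EnsuresA G S v₀ (G.UntilB F (α N)) := by
  refine ⟨fun K N hK => ?_, ?_⟩
  · obtain ⟨V, hV, G, F, v₀, hS, hlow⟩ := exists_game_separating_memory K N hK
    exact ⟨V, hV, G, F, v₀, hS, fun M _ hM => hlow M hM.le⟩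
  · rintro ⟨mem, α, h⟩
    obtain ⟨V, hV, G, F, v₀, ⟨S, hS, hens⟩, hlow⟩ :=
      exists_game_separating_memory (mem 1 + 1) (α ((mem 1 + 1) * (mem 1 + 1 + 3))) (by omega)
    obtain ⟨S', hS', hens'⟩ := h V hV G F v₀ _ ⟨_, S, hS, hens⟩
    exact hlow _ (by simp; omega) S' hS' hens'
end
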